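/- Let λ ∈ ℂ with λ ≠ 0, and let f be a holomorphic function on the slit plane Ω = ℂ ∖ (−∞, 0] satisfying 4·(z·f″(z) + f′(z)) = λ·f(z) for all z ∈ Ω. Then there exists a unique pair (a, b) ∈ ℂ² such that f(z) = a·Φ_λ(z) + b·W_λ(z) for all z ∈ Ω; that is, (Φ_λ, W_λ) is a basis of the space of holomorphic solutions on Ω of L_c f = λf. -/

import Mathlib

/-- The entire function `Φ_λ(z) = Σ_{n≥0} (λz)ⁿ/(4ⁿ (n!)²)`. -/
noncomputable def Phi (lam z : ℂ) : ℂ :=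
  ∑' n : ℕ, (lam * z) ^ n / (4 ^ n * (n.factorial : ℂ) ^ 2)

/-- `a(n) = −2 Γ′(n+1)/Γ(n+1)` where `Γ` is the real Gamma function. -/
noncomputable def aCoef (n : ℕ) : ℝ :=
  -2 * deriv Real.Gamma ((n : ℝ) + 1) / Real.Gamma ((n : ℝ) + 1)

/-- The entire function `w_λ(z) = Σ_{n≥0} a(n) (λz)ⁿ/(4ⁿ (n!)²)`. -/
noncomputable def wFun (lam z : ℂ) : ℂ :=
  ∑' n : ℕ, (aCoef n : ℂ) * (lam * z) ^ n / (4 ^ n * (n.factorial : ℂ) ^ 2)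

/-- `W_λ(z) = w_λ(z) + Log(z) Φ_λ(z)` with the principal branch of the logarithm. -/
noncomputable def W (lam z : ℂ) : ℂ := wFun lam z + Complex.log z * Phi lam z

/-- The sum of the power series with coefficients `c`. -/
noncomputable def powSum (c : ℕ → ℂ) (z : ℂ) : ℂ := ∑' n, c n * z ^ n

/-- The coefficients of the termwise derivative. -/
def derivCoef (c : ℕ → ℂ) (n : ℕ) : ℂ := (n + 1) * c (n + 1)

/-- Coefficients bounded by those of an exponential. -/
def ExpBounded (c : ℕ → ℂ) : Prop :=
  ∃ K A : ℝ, 0 ≤ K ∧ 0 ≤ A ∧ ∀ n, ‖c n‖ ≤ K * (A ^ n / n.factorial)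

namespace ExpBounded

variable {c : ℕ → ℂ}

lemma summable_norm_mul_pow (hc : ExpBounded c) {r : ℝ} (hr : 0 ≤ r) :
    Summable fun n => ‖c n‖ * r ^ n := by
  obtain ⟨K, A, hK, hA, h⟩ := hc
  refine Summable.of_nonneg_of_le (fun n => by positivity) (fun n => ?_)
    ((Real.summable_pow_div_factorial (A * r)).mul_left K)
  calc ‖c n‖ * r ^ n ≤ K * (A ^ n / n.factorial) * r ^ n := by gcongr; exact h n
    _ = K * ((A * r) ^ n / n.factorial) := by rw [mul_pow]; ring

lemma summable (hc : ExpBounded c) (z : ℂ) : Summable fun n => c n * z ^ n :=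
  .of_norm <| by simpa using hc.summable_norm_mul_pow (norm_nonneg z)

protected lemma derivCoef (hc : ExpBounded c) : ExpBounded (derivCoef c) := by
  obtain ⟨K, A, hK, hA, h⟩ := hc
  refine ⟨K * A, A, by positivity, hA, fun n => ?_⟩
  have hn : ‖(n : ℂ) + 1‖ = (n : ℝ) + 1 := by exact_mod_cast Complex.norm_natCast (n + 1)
  calc ‖derivCoef c n‖ = (n + 1) * ‖c (n + 1)‖ := by rw [derivCoef, norm_mul, hn]
    _ ≤ (n + 1) * (K * (A ^ (n + 1) / (n + 1).factorial)) := by gcongr; exact h _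
    _ = K * A * (A ^ n / n.factorial) := by
      rw [Nat.factorial_succ]; push_cast; field_simp; ring

lemma mul_of_le_two_pow (hc : ExpBounded c) {b : ℕ → ℂ} {C : ℝ}
    (hb : ∀ n, ‖b n‖ ≤ C * 2 ^ n) : ExpBounded fun n => b n * c n := by
  obtain ⟨K, A, hK, hA, h⟩ := hc
  have hC : 0 ≤ C := by simpa using (norm_nonneg _).trans (hb 0)
  refine ⟨C * K, 2 * A, by positivity, by positivity, fun n => ?_⟩
  calc ‖b n * c n‖ ≤ (C * 2 ^ n) * (K * (A ^ n / n.factorial)) := by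
        rw [norm_mul]; gcongr; exacts [hb n, h n]
    _ = C * K * ((2 * A) ^ n / n.factorial) := by rw [mul_pow]; ring

lemma natCast_mul (hc : ExpBounded c) : ExpBounded fun n => n * c n :=
  hc.mul_of_le_two_pow (C := 1) fun n => by
    rw [Complex.norm_natCast, one_mul]
    exact_mod_cast Nat.lt_two_pow_self.le

lemma mul_powSum_derivCoef (hc : ExpBounded c) (z : ℂ) :
    z * powSum (derivCoef c) z = powSum (fun n => n * c n) z := by
  simp only [powSum]
  rw [(hc.natCast_mul.summable z).tsum_eq_zero_add, ← tsum_mul_left]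
  simp only [derivCoef, Nat.cast_zero, zero_mul, zero_add, Nat.cast_add, Nat.cast_one]
  exact tsum_congr fun n => by ring

lemma hasDerivAt_powSum (hc : ExpBounded c) (z : ℂ) :
    HasDerivAt (powSum c) (powSum (derivCoef c) z) z := by
  set R : ℝ := ‖z‖ + 1
  have hR : 0 < R := by positivity
  have hu : Summable fun n : ℕ => ‖c n‖ * (n * R ^ (n - 1)) := by
    refine (summable_nat_add_iff 1).1 ((hc.derivCoef.summable_norm_mul_pow hR.le).congr fun n => ?_)
    have hn : ‖(n : ℂ) + 1‖ = (n : ℝ) + 1 := by exact_mod_cast Complex.norm_natCast (n + 1)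
    rw [derivCoef, norm_mul, hn, Nat.add_sub_cancel]
    push_cast
    ring
  have hbound : ∀ (n : ℕ) (y : ℂ), y ∈ Metric.ball (0 : ℂ) R →
      ‖c n * (n * y ^ (n - 1))‖ ≤ ‖c n‖ * (n * R ^ (n - 1)) := fun n y hy => by
    rw [norm_mul, norm_mul, norm_pow, Complex.norm_natCast]
    gcongr
    simpa using (Metric.mem_ball.1 hy).le
  have hz : z ∈ Metric.ball (0 : ℂ) R := by simp [R]
  have key := hasDerivAt_tsum_of_isPreconnected hu Metric.isOpen_ball
    (convex_ball (0 : ℂ) R).isPreconnected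
    (fun n y _ => (hasDerivAt_pow n y).const_mul (c n)) hbound hz (hc.summable z) hz
  refine key.congr_deriv ?_
  have hs : Summable fun n : ℕ => c n * (n * z ^ (n - 1)) :=
    .of_norm_bounded hu fun n => hbound n z hz
  rw [hs.tsum_eq_zero_add, powSum]
  simp only [derivCoef, Nat.cast_zero, zero_mul, mul_zero, zero_add, Nat.cast_add, Nat.cast_one,
    Nat.add_sub_cancel]
  exact tsum_congr fun n => by ring

lemma hasDerivAt_mul_powSum_derivCoef (hc : ExpBounded c) (z : ℂ) :
    HasDerivAt (fun z => z * powSum (derivCoef c) z)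
      (powSum (derivCoef fun n => n * c n) z) z := by
  simp_rw [hc.mul_powSum_derivCoef]
  exact hc.natCast_mul.hasDerivAt_powSum z

end ExpBounded

lemma aCoef_eq (n : ℕ) : aCoef n = 2 * Real.eulerMascheroniConstant - 2 * harmonic n := by
  rw [aCoef, Real.deriv_Gamma_nat, Real.Gamma_nat_eq_factorial]
  have : (n.factorial : ℝ) ≠ 0 := by positivity
  field_simp
  ring

lemma aCoef_succ (n : ℕ) : aCoef (n + 1) = aCoef n - 2 / (n + 1) := by
  rw [aCoef_eq, aCoef_eq, harmonic_succ]
  push_cast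
  ring

lemma abs_aCoef_le (n : ℕ) : |aCoef n| ≤ (|aCoef 0| + 2) * 2 ^ n := by
  induction n with
  | zero => simp
  | succ n ih =>
    have h1 : |2 / ((n : ℝ) + 1)| ≤ 2 := by
      rw [abs_of_nonneg (by positivity)]
      exact div_le_self (by norm_num) (by linarith [n.cast_nonneg (α := ℝ)])
    have h2 : (2 : ℝ) ≤ (|aCoef 0| + 2) * 2 ^ n := by
      nlinarith [abs_nonneg (aCoef 0), one_le_pow₀ (M₀ := ℝ) (n := n) one_le_two]
    rw [aCoef_succ, pow_succ]
    linarith [abs_sub (aCoef n) (2 / ((n : ℝ) + 1))]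

/-- The Taylor coefficients of `Φ_λ`. -/
noncomputable def phiCoef (lam : ℂ) (n : ℕ) : ℂ := lam ^ n / (4 ^ n * (n.factorial : ℂ) ^ 2)

lemma expBounded_phiCoef (lam : ℂ) : ExpBounded (phiCoef lam) := by
  refine ⟨1, ‖lam‖, zero_le_one, norm_nonneg _, fun n => ?_⟩
  rw [phiCoef, norm_div, norm_mul, norm_pow, norm_pow, norm_pow, Complex.norm_natCast,
    Complex.norm_ofNat, one_mul]
  have h1 : (1 : ℝ) ≤ n.factorial := by exact_mod_cast n.factorial_pos
  have h4 : (1 : ℝ) ≤ 4 ^ n := one_le_pow₀ (by norm_num)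
  gcongr
  nlinarith

lemma expBounded_aCoef_mul_phiCoef (lam : ℂ) : ExpBounded fun n => aCoef n * phiCoef lam n :=
  (expBounded_phiCoef lam).mul_of_le_two_pow fun n => by
    rw [Complex.norm_real, Real.norm_eq_abs]
    exact abs_aCoef_le n

lemma sq_mul_phiCoef_succ (lam : ℂ) (n : ℕ) :
    ((n : ℂ) + 1) ^ 2 * phiCoef lam (n + 1) = lam / 4 * phiCoef lam n := by
  have h : (n : ℂ) + 1 ≠ 0 := Nat.cast_add_one_ne_zero n
  have hf : (n.factorial : ℂ) ≠ 0 := by exact_mod_cast n.factorial_ne_zero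
  simp only [phiCoef, Nat.factorial_succ]
  push_cast
  field_simp
  ring

lemma Phi_eq_powSum (lam : ℂ) : Phi lam = powSum (phiCoef lam) := by
  funext z
  exact tsum_congr fun n => by rw [phiCoef, mul_pow]; ring

lemma wFun_eq_powSum (lam : ℂ) : wFun lam = powSum fun n => aCoef n * phiCoef lam n := by
  funext z
  exact tsum_congr fun n => by simp only [phiCoef, mul_pow]; ring

lemma hasDerivAt_Phi (lam z : ℂ) : HasDerivAt (Phi lam) (powSum (derivCoef (phiCoef lam)) z) z :=
  Phi_eq_powSum lam ▸ (expBounded_phiCoef lam).hasDerivAt_powSum z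

lemma hasDerivAt_wFun (lam z : ℂ) :
    HasDerivAt (wFun lam) (powSum (derivCoef fun n => aCoef n * phiCoef lam n) z) z :=
  wFun_eq_powSum lam ▸ (expBounded_aCoef_mul_phiCoef lam).hasDerivAt_powSum z

lemma hasDerivAt_mul_deriv_Phi (lam z : ℂ) :
    HasDerivAt (fun z => z * deriv (Phi lam) z) (lam / 4 * Phi lam z) z := by
  have h := (expBounded_phiCoef lam).hasDerivAt_mul_powSum_derivCoef z
  simp_rw [(hasDerivAt_Phi lam _).deriv]
  convert h using 1
  rw [Phi_eq_powSum, powSum, powSum, ← tsum_mul_left]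
  refine tsum_congr fun n => ?_
  rw [← mul_assoc, ← sq_mul_phiCoef_succ, derivCoef]
  push_cast
  ring

lemma hasDerivAt_mul_deriv_wFun (lam z : ℂ) :
    HasDerivAt (fun z => z * deriv (wFun lam) z)
      (lam / 4 * wFun lam z - 2 * deriv (Phi lam) z) z := by
  have h := (expBounded_aCoef_mul_phiCoef lam).hasDerivAt_mul_powSum_derivCoef z
  simp_rw [(hasDerivAt_wFun lam _).deriv]
  convert h using 1
  rw [(hasDerivAt_Phi lam z).deriv, wFun_eq_powSum, powSum, powSum, powSum, ← tsum_mul_left,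
    ← tsum_mul_left, ← Summable.tsum_sub
      (((expBounded_aCoef_mul_phiCoef lam).summable z).mul_left _)
      (((expBounded_phiCoef lam).derivCoef.summable z).mul_left _)]
  refine tsum_congr fun n => ?_
  have h1 : (n : ℂ) + 1 ≠ 0 := Nat.cast_add_one_ne_zero n
  have h2 := sq_mul_phiCoef_succ lam n
  simp only [derivCoef, aCoef_succ]
  push_cast
  field_simp
  linear_combination (-4 * (aCoef n : ℂ) * z ^ n) * h2

/-- The entire function `z (Φ_λ w_λ' − Φ_λ' w_λ) + Φ_λ²` is constant. -/
lemma wronskian_Phi_wFun (lam z : ℂ) :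
    Phi lam z * (z * deriv (wFun lam) z) - z * deriv (Phi lam) z * wFun lam z + Phi lam z ^ 2
      = 1 := by
  have hd (z : ℂ) := (((hasDerivAt_Phi lam z).mul (hasDerivAt_mul_deriv_wFun lam z)).sub
    ((hasDerivAt_mul_deriv_Phi lam z).mul (hasDerivAt_wFun lam z))).add
      ((hasDerivAt_Phi lam z).pow 2)
  have hconst := is_const_of_deriv_eq_zero (fun z => (hd z).differentiableAt)
    (fun z => by
      rw [(hd z).deriv, ← (hasDerivAt_Phi lam z).deriv, ← (hasDerivAt_wFun lam z).deriv]
      push_cast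
      ring) z 0
  have h0 : Phi lam 0 = 1 := by
    rw [Phi, tsum_eq_single 0 fun n hn => by simp [hn]]
    simp
  simpa [h0] using hconst

/-- Solutions of `4 (z f″ + f′) = λ f` on the slit plane, in the form `(z f′)′ = (λ/4) f`. -/
def IsSlitSolution (lam : ℂ) (f : ℂ → ℂ) : Prop :=
  ∀ z ∈ Complex.slitPlane, DifferentiableAt ℂ f z ∧
    HasDerivAt (fun z => z * deriv f z) (lam / 4 * f z) z

lemma IsSlitSolution.exists_wronskian_eq {lam : ℂ} {f g : ℂ → ℂ} (hf : IsSlitSolution lam f)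
    (hg : IsSlitSolution lam g) :
    ∃ c, ∀ z ∈ Complex.slitPlane, f z * (z * deriv g z) - z * deriv f z * g z = c := by
  have hd (z : ℂ) (hz : z ∈ Complex.slitPlane) :=
    ((hf z hz).1.hasDerivAt.mul (hg z hz).2).sub ((hf z hz).2.mul (hg z hz).1.hasDerivAt)
  refine Complex.isOpen_slitPlane.exists_is_const_of_deriv_eq_zero
    (Complex.starConvex_one_slitPlane.isPathConnected
      Complex.one_mem_slitPlane).isConnected.isPreconnected
    (fun z hz => (hd z hz).differentiableAt.differentiableWithinAt) fun z hz => ?_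
  refine (hd z hz).deriv.trans ?_
  rw [Pi.zero_apply]
  ring

lemma isSlitSolution_Phi (lam : ℂ) : IsSlitSolution lam (Phi lam) := fun z _ =>
  ⟨(hasDerivAt_Phi lam z).differentiableAt, hasDerivAt_mul_deriv_Phi lam z⟩

lemma hasDerivAt_W (lam : ℂ) {z : ℂ} (hz : z ∈ Complex.slitPlane) :
    HasDerivAt (W lam)
      (deriv (wFun lam) z + (z⁻¹ * Phi lam z + Complex.log z * deriv (Phi lam) z)) z :=
  (hasDerivAt_wFun lam z).differentiableAt.hasDerivAt.add
    ((Complex.hasDerivAt_log hz).mul (hasDerivAt_Phi lam z).differentiableAt.hasDerivAt)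

lemma mul_deriv_W (lam : ℂ) {z : ℂ} (hz : z ∈ Complex.slitPlane) :
    z * deriv (W lam) z =
      z * deriv (wFun lam) z + (Phi lam z + Complex.log z * (z * deriv (Phi lam) z)) := by
  have := Complex.slitPlane_ne_zero hz
  rw [(hasDerivAt_W lam hz).deriv]
  field_simp

lemma isSlitSolution_W (lam : ℂ) : IsSlitSolution lam (W lam) := fun z hz => by
  refine ⟨(hasDerivAt_W lam hz).differentiableAt, ?_⟩
  have h := (hasDerivAt_mul_deriv_wFun lam z).add
    ((hasDerivAt_Phi lam z).differentiableAt.hasDerivAt.add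
      ((Complex.hasDerivAt_log hz).mul (hasDerivAt_mul_deriv_Phi lam z)))
  refine (h.congr_of_eventuallyEq ?_).congr_deriv ?_
  · filter_upwards [Complex.isOpen_slitPlane.mem_nhds hz] with y hy using mul_deriv_W lam hy
  · have := Complex.slitPlane_ne_zero hz
    rw [W]
    field_simp
    ring

lemma wronskian_Phi_W (lam : ℂ) {z : ℂ} (hz : z ∈ Complex.slitPlane) :
    Phi lam z * (z * deriv (W lam) z) - z * deriv (Phi lam) z * W lam z = 1 := by
  rw [mul_deriv_W lam hz, W, ← wronskian_Phi_wFun lam z]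
  ring

lemma isSlitSolution_of_ode {lam : ℂ} {f : ℂ → ℂ} (hf : DifferentiableOn ℂ f Complex.slitPlane)
    (hode : ∀ z ∈ Complex.slitPlane, 4 * (z * deriv (deriv f) z + deriv f z) = lam * f z) :
    IsSlitSolution lam f := fun z hz => by
  have hnhds := Complex.isOpen_slitPlane.mem_nhds hz
  refine ⟨hf.differentiableAt hnhds, ?_⟩
  have h := (hasDerivAt_id z).mul
    ((hf.deriv Complex.isOpen_slitPlane).differentiableAt hnhds).hasDerivAt
  refine h.congr_deriv ?_
  simp only [id]
  linear_combination hode z hz / 4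

/-- `(Φ_λ, W_λ)` is a basis of the space of holomorphic solutions of `L_c f = λ f`
on the slit plane: every holomorphic `f` on `ℂ ∖ (−∞,0]` with
`4 (z f″(z) + f′(z)) = λ f(z)` is a unique linear combination `a Φ_λ + b W_λ`. -/
theorem solutions_basis (lam : ℂ) (hlam : lam ≠ 0) (f : ℂ → ℂ)
    (hf : DifferentiableOn ℂ f Complex.slitPlane)
    (hode : ∀ z ∈ Complex.slitPlane,
      4 * (z * deriv (deriv f) z + deriv f z) = lam * f z) :
    ∃! ab : ℂ × ℂ, ∀ z ∈ Complex.slitPlane,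
      f z = ab.1 * Phi lam z + ab.2 * W lam z := by
  have hsol := isSlitSolution_of_ode hf hode
  obtain ⟨b, hb⟩ := (isSlitSolution_Phi lam).exists_wronskian_eq hsol
  obtain ⟨a, ha⟩ := hsol.exists_wronskian_eq (isSlitSolution_W lam)
  refine ⟨(a, b), fun z hz => ?_, fun ⟨a', b'⟩ h => ?_⟩
  · rw [← ha z hz, ← hb z hz]
    linear_combination (-f z) * wronskian_Phi_W lam hz
  · have h1 := Complex.one_mem_slitPlane
    have hPhi := (hasDerivAt_Phi lam 1).differentiableAt.hasDerivAt
    have hW := (hasDerivAt_W lam h1).differentiableAt.hasDerivAt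
    have hderiv : deriv f 1 = a' * deriv (Phi lam) 1 + b' * deriv (W lam) 1 := by
      refine (((hPhi.const_mul a').add (hW.const_mul b')).congr_of_eventuallyEq ?_).deriv
      filter_upwards [Complex.isOpen_slitPlane.mem_nhds h1] with y hy using h y hy
    have hf1 := h 1 h1
    have hw := wronskian_Phi_W lam h1
    ext
    · change a' = a
      rw [← ha 1 h1, hderiv, hf1]
      linear_combination (-a') * hw
    · change b' = b
      rw [← hb 1 h1, hderiv, hf1]
      linear_combination (-b') * hw
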